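/- Let V be a finitely generated free ℤ-module with dual V* = Hom_ℤ(V, ℤ), let d be a nonzero integer, and let m : V → V* be a ℤ-linear map whose polarization has symmetric mod d reduction, i.e. m(x)(y) ≡ m(y)(x) (mod d) for all x, y ∈ V. Set K := ker(ρ_d m) = {y ∈ V : m(y) ∈ dV*} and let K^⊥ := {[c] ∈ V*/dV* : c(y) ≡ 0 (mod d) for all y ∈ K}. Then the image of ρ_d m : V → V*/dV* equals K^⊥. -/

import Mathlib

/-- The submodule `d V*` of `V* = Hom_ℤ(V, ℤ)`. -/
def dDual (V : Type*) [AddCommGroup V] [Module ℤ V] (d : ℤ) :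
    Submodule ℤ (V →ₗ[ℤ] ℤ) :=
  LinearMap.range (d • (LinearMap.id : (V →ₗ[ℤ] ℤ) →ₗ[ℤ] (V →ₗ[ℤ] ℤ)))

/-- A character of `V*` killing `d V*` is, up to the inclusion `(1/d)ℤ/ℤ ⊆ ℚ/ℤ`, the reduction
modulo `d` of the evaluation at some vector of `V`. -/
lemma exists_forall_character_eq_apply_div {V : Type*} [AddCommGroup V] [Module ℤ V]
    [Module.Free ℤ V] [Module.Finite ℤ V] {d : ℤ} (hd : d ≠ 0)
    (ψ : (V →ₗ[ℤ] ℤ) →+ AddCircle (1 : ℚ)) (hψ : ∀ f, d • ψ f = 0) :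
    ∃ y : V, ∀ f, ψ f = (((f y : ℚ) / d : ℚ) : AddCircle (1 : ℚ)) := by
  have hdq : (d : ℚ) ≠ 0 := by exact_mod_cast hd
  have torsion : ∀ a : AddCircle (1 : ℚ), d • a = 0 →
      ∃ k : ℤ, a = (((k : ℚ) / d : ℚ) : AddCircle (1 : ℚ)) := by
    intro a ha
    obtain ⟨q, rfl⟩ := QuotientAddGroup.mk_surjective a
    have ha' : ((d • q : ℚ) : AddCircle (1 : ℚ)) = 0 := ha
    obtain ⟨k, hk⟩ := (AddCircle.coe_eq_zero_iff (1 : ℚ)).1 ha'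
    refine ⟨k, congrArg _ ?_⟩
    simp only [zsmul_eq_mul, mul_one] at hk
    rw [hk]
    field_simp
  let b := Module.Free.chooseBasis ℤ V
  choose k hk using fun i => torsion (ψ (b.coord i)) (hψ _)
  refine ⟨∑ i, k i • b i, fun f => ?_⟩
  have hf : ψ f = ∑ i, f (b i) • ψ (b.coord i) := by
    conv_lhs => rw [← b.sum_dual_apply_smul_coord f]
    simp only [map_sum, map_zsmul]
  rw [hf]
  simp only [hk, ← AddCircle.coe_zsmul, map_sum, map_zsmul]
  rw [← QuotientAddGroup.mk_sum]
  congr 1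
  push_cast
  rw [Finset.sum_div]
  refine Finset.sum_congr rfl fun i _ => ?_
  simp only [zsmul_eq_mul, smul_eq_mul]
  push_cast
  ring

/-- A linear form all of whose values are divisible by `d` lies in `d V*`. -/
lemma exists_eq_smul_of_forall_dvd {V : Type*} [AddCommGroup V] [Module ℤ V]
    [Module.Free ℤ V] {d : ℤ} (f : V →ₗ[ℤ] ℤ) (hf : ∀ x, d ∣ f x) :
    ∃ t : V →ₗ[ℤ] ℤ, f = d • t := by
  let b := Module.Free.chooseBasis ℤ V
  choose g hg using fun i => hf (b i)
  refine ⟨b.constr ℤ g, b.ext fun i => ?_⟩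
  simp [hg, Module.Basis.constr_basis]

/-- A submodule of `V*` containing `d V*` contains every linear form that vanishes modulo `d` at
each vector where the whole submodule vanishes modulo `d`. -/
lemma mem_of_forall_dvd_apply {V : Type*} [AddCommGroup V] [Module ℤ V]
    [Module.Free ℤ V] [Module.Finite ℤ V] {d : ℤ} (hd : d ≠ 0)
    (L : Submodule ℤ (V →ₗ[ℤ] ℤ)) (hL : ∀ f, d • f ∈ L) (c : V →ₗ[ℤ] ℤ)
    (hc : ∀ y : V, (∀ f ∈ L, d ∣ f y) → d ∣ c y) : c ∈ L := by
  by_contra hcL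
  have hdq : (d : ℚ) ≠ 0 := by exact_mod_cast hd
  obtain ⟨χ, hχ⟩ := CharacterModule.exists_character_apply_ne_zero_of_ne_zero
    (a := L.mkQ c) (by simpa using hcL)
  let ψ : (V →ₗ[ℤ] ℤ) →+ AddCircle (1 : ℚ) := AddMonoidHom.comp χ L.mkQ.toAddMonoidHom
  have hψL : ∀ f ∈ L, ψ f = 0 := fun f hf => by
    change χ (L.mkQ f) = 0
    rw [L.mkQ_apply, (Submodule.Quotient.mk_eq_zero L).2 hf, map_zero]
  obtain ⟨y, hy⟩ := exists_forall_character_eq_apply_div hd ψ fun f => by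
    rw [← map_zsmul]
    exact hψL _ (hL f)
  have hzero : ∀ f, ψ f = 0 ↔ d ∣ f y := fun f => by
    rw [hy, AddCircle.coe_eq_zero_iff]
    constructor
    · rintro ⟨n, hn⟩
      refine ⟨n, ?_⟩
      simp only [zsmul_eq_mul, mul_one] at hn
      field_simp at hn
      rw [mul_comm]
      exact_mod_cast hn.symm
    · rintro ⟨n, hn⟩
      refine ⟨n, ?_⟩
      rw [hn]
      simp only [zsmul_eq_mul, mul_one]
      push_cast
      field_simp
  exact hχ ((hzero c).2 (hc y fun f hf => (hzero f).1 (hψL f hf)))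

/-- Let `V` be a finitely generated free ℤ-module with dual
`V* = Hom_ℤ(V, ℤ)`, let `d` be a nonzero integer, and let `m : V → V*` be a
ℤ-linear map whose polarization has symmetric mod `d` reduction, i.e.
`m x y ≡ m y x (mod d)` for all `x y : V`.  Set `K := ker (ρ_d m) = {y : m y ∈ d V*}`
and let `K^⊥ ⊆ V*/dV*` consist of the classes `[c]` with `c y ≡ 0 (mod d)` for all
`y ∈ K`.  Then the image of `ρ_d m : V → V*/dV*` equals `K^⊥`. -/
theorem stmt4 (V : Type*) [AddCommGroup V] [Module ℤ V]
    [Module.Free ℤ V] [Module.Finite ℤ V]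
    (d : ℤ) (hd : d ≠ 0)
    (m : V →ₗ[ℤ] (V →ₗ[ℤ] ℤ))
    (hsym : ∀ x y : V, d ∣ m x y - m y x) :
    (LinearMap.range ((dDual V d).mkQ.comp m) : Set ((V →ₗ[ℤ] ℤ) ⧸ dDual V d)) =
      {q | ∀ c : V →ₗ[ℤ] ℤ, Submodule.Quotient.mk c = q →
        ∀ y : V, (∃ t : V →ₗ[ℤ] ℤ, m y = d • t) → d ∣ c y} := by
  ext q
  constructor
  · rintro ⟨x, rfl⟩ c hc y ⟨t, ht⟩
    obtain ⟨s, hs⟩ := (Submodule.Quotient.eq (dDual V d)).1 hc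
    have hcy : c y - m x y = d * s y := by
      simpa using (LinearMap.congr_fun hs y).symm
    have hyx : m y x = d * t x := by simp [ht]
    have hdvd := dvd_add (hsym x y) (Dvd.intro _ hcy.symm)
    have := dvd_add hdvd (Dvd.intro _ hyx.symm)
    ring_nf at this
    exact this
  · obtain ⟨c, rfl⟩ := Submodule.Quotient.mk_surjective _ q
    intro hc
    have hmem : c ∈ LinearMap.range m ⊔ dDual V d := by
      refine mem_of_forall_dvd_apply hd _
        (fun f => Submodule.mem_sup_right (LinearMap.mem_range.2 ⟨f, by simp⟩)) c fun y hy => ?_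
      refine hc c rfl y (exists_eq_smul_of_forall_dvd _ fun x => ?_)
      have hxy := hy (m x) (Submodule.mem_sup_left ⟨x, rfl⟩)
      exact (dvd_iff_dvd_of_dvd_sub (hsym x y)).1 hxy
    obtain ⟨_, ⟨x, rfl⟩, g, hg, rfl⟩ := Submodule.mem_sup.1 hmem
    refine ⟨x, (Submodule.Quotient.eq _).2 ?_⟩
    simpa using hg
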